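/- arXiv:2203.07192 — 8 statements merged into one kernel-verified Lean document; each statement's English description precedes it below -/
import Mathlib

section
/- Let α and β be nonempty finite types. Let (W, H₁, H₂, s) be a nonlinear entanglement witness on α × β. Let G = Σ_{i∈I} p_i A_i ⊗ B_i be a finite sum with real weights p_i ≥ 0 and positive semidefinite complex matrices A_i indexed by α and B_i indexed by β. Let Λ be a linear map on complex matrices indexed by α × β whose Hilbert–Schmidt adjoint Λ⁺ maps every separable positive semidefinite operator indexed by α × β to a separable positive semidefinite operator. Let τ_s (s ∈ S), ω_t (t ∈ T), α_{st}, β_{st}, γ_{st} be decompositions of W, H₁, H₂ as in the decomposition assumption. Assume the real number tr(G·Λ(1)) is strictly positive (1 the identity matrix). Then the noisy MDI nonlinear witness value N^Λ := Σ_{s,t} α_{st}·tr(G·Λ(τ_s^T ⊗ ω_t^T)) − (1/(s·tr(G·Λ(1))))·[(Σ_{s,t} β_{st}·tr(G·Λ(τ_s^T ⊗ ω_t^T)))² + (Σ_{s,t} γ_{st}·tr(G·Λ(τ_s^T ⊗ ω_t^T)))²] is a nonnegative real number. -/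
open Matrix Kronecker BigOperators ComplexOrder

noncomputable section

/-- A density matrix: a positive semidefinite complex matrix with trace 1. -/
def IsDensity {n : Type*} [Fintype n] (ρ : Matrix n n ℂ) : Prop :=
  ρ.PosSemidef ∧ ρ.trace = 1

/-- A separable density matrix on a product index type. -/
def IsSepDensity {α β : Type*} [Fintype α] [Fintype β]
    (ρ : Matrix (α × β) (α × β) ℂ) : Prop :=
  ∃ (m : ℕ) (p : Fin m → ℝ) (σA : Fin m → Matrix α α ℂ) (σB : Fin m → Matrix β β ℂ),
    (∀ i, 0 ≤ p i) ∧ (∑ i, p i) = 1 ∧ (∀ i, IsDensity (σA i)) ∧ (∀ i, IsDensity (σB i)) ∧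
    ρ = ∑ i, (p i : ℂ) • (σA i ⊗ₖ σB i)

/-- A separable positive semidefinite operator: a finite sum of Kronecker products of
positive semidefinite matrices. -/
def IsSepPSD {α β : Type*} [Fintype α] [Fintype β]
    (ρ : Matrix (α × β) (α × β) ℂ) : Prop :=
  ∃ (m : ℕ) (C : Fin m → Matrix α α ℂ) (D : Fin m → Matrix β β ℂ),
    (∀ i, (C i).PosSemidef) ∧ (∀ i, (D i).PosSemidef) ∧ ρ = ∑ i, C i ⊗ₖ D i

/-- `Λa` is the Hilbert–Schmidt adjoint of `Λ`. -/
def IsHSAdjoint {n : Type*} [Fintype n]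
    (Λ Λa : Matrix n n ℂ →ₗ[ℂ] Matrix n n ℂ) : Prop :=
  ∀ M N : Matrix n n ℂ, (M * Λ N).trace = (Λa M * N).trace

/-- The operator `τ ⊗ ρ ⊗ ω` with Alice's two tensor factors and Bob's two tensor
factors grouped together. -/
def Mop {α β : Type*} (τ : Matrix α α ℂ) (ρ : Matrix (α × β) (α × β) ℂ)
    (ω : Matrix β β ℂ) : Matrix ((α × α) × (β × β)) ((α × α) × (β × β)) ℂ :=
  Matrix.of fun x y =>
    τ x.1.1 y.1.1 * ρ (x.1.2, x.2.1) (y.1.2, y.2.1) * ω x.2.2 y.2.2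

/-- Partial trace over the second tensor factor. -/
def ptr2 {α β : Type*} [Fintype β] (A : Matrix (α × β) (α × β) ℂ) : Matrix α α ℂ :=
  Matrix.of fun a a' => ∑ b, A (a, b) (a', b)

/-- Partial trace over the first tensor factor. -/
def ptr1 {α β : Type*} [Fintype α] (A : Matrix (α × β) (α × β) ℂ) : Matrix β β ℂ :=
  Matrix.of fun b b' => ∑ a, A (a, b) (a, b')

/-- Partial transpose on the second subsystem. -/
def ptB {α β : Type*} (M : Matrix (α × β) (α × β) ℂ) : Matrix (α × β) (α × β) ℂ :=
  Matrix.of fun x y => M (x.1, y.2) (y.1, x.2)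


/-- Every positive semidefinite matrix is its trace times a density matrix. -/
theorem Matrix.PosSemidef.exists_eq_trace_smul_density {n : Type*} [Fintype n] [DecidableEq n]
    [Nonempty n] {C : Matrix n n ℂ} (hC : C.PosSemidef) :
    ∃ σ : Matrix n n ℂ, IsDensity σ ∧ C = C.trace • σ := by
  by_cases h : C.trace = 0
  · refine ⟨((Fintype.card n : ℂ)⁻¹) • 1, ⟨PosSemidef.one.smul (by positivity), ?_⟩, ?_⟩
    · simp [Matrix.trace_smul, Matrix.trace_one]
    · rw [h, zero_smul, ← hC.trace_eq_zero_iff]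
      exact h
  · refine ⟨C.trace⁻¹ • C, ⟨hC.smul (inv_nonneg.2 hC.trace_nonneg), ?_⟩, ?_⟩
    · rw [Matrix.trace_smul, smul_eq_mul, inv_mul_cancel₀ h]
    · rw [smul_smul, mul_inv_cancel₀ h, one_smul]

/-- A family of Kronecker products over any finite index type sums to a separable operator. -/
theorem isSepPSD_sum_kronecker {α β I : Type*} [Fintype α] [Fintype β] [Fintype I]
    {C : I → Matrix α α ℂ} {D : I → Matrix β β ℂ}
    (hC : ∀ i, (C i).PosSemidef) (hD : ∀ i, (D i).PosSemidef) :
    IsSepPSD (∑ i, C i ⊗ₖ D i) :=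
  let e := (Fintype.equivFin I).symm
  ⟨Fintype.card I, fun i => C (e i), fun i => D (e i), fun i => hC (e i), fun i => hD (e i),
    (e.sum_comp fun i => C i ⊗ₖ D i).symm⟩

/-- A separable operator with positive trace is its trace times a separable density matrix. -/
theorem IsSepPSD.exists_eq_trace_smul_sepDensity {α β : Type*}
    [Fintype α] [DecidableEq α] [Nonempty α] [Fintype β] [DecidableEq β] [Nonempty β]
    {R : Matrix (α × β) (α × β) ℂ} (hR : IsSepPSD R) (hpos : 0 < R.trace) :
    ∃ Q : Matrix (α × β) (α × β) ℂ, IsSepDensity Q ∧ R = R.trace • Q := by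
  obtain ⟨m, C, D, hC, hD, hRCD⟩ := hR
  choose σ hσ hCσ using fun i => (hC i).exists_eq_trace_smul_density
  choose τ hτ hDτ using fun i => (hD i).exists_eq_trace_smul_density
  have htr : R.trace = ∑ i, (C i).trace * (D i).trace := by
    simp [hRCD, Matrix.trace_sum, Matrix.trace_kronecker]
  have hq : ∀ i, 0 ≤ R.trace⁻¹ * ((C i).trace * (D i).trace) := fun i =>
    mul_nonneg (inv_nonneg.2 hpos.le) (mul_nonneg (hC i).trace_nonneg (hD i).trace_nonneg)
  have hre : ∀ i, (((R.trace⁻¹ * ((C i).trace * (D i).trace)).re : ℝ) : ℂ) =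
      R.trace⁻¹ * ((C i).trace * (D i).trace) := fun i =>
    (Complex.eq_re_of_ofReal_le (r := 0) (by simpa using hq i)).symm
  refine ⟨R.trace⁻¹ • R,
    ⟨m, fun i => (R.trace⁻¹ * ((C i).trace * (D i).trace)).re, σ, τ,
      fun i => (Complex.nonneg_iff.1 (hq i)).1, ?_, hσ, hτ, ?_⟩, ?_⟩
  · apply Complex.ofReal_injective
    rw [Complex.ofReal_sum, Finset.sum_congr rfl fun i _ => hre i, ← Finset.mul_sum, ← htr,
      inv_mul_cancel₀ hpos.ne', Complex.ofReal_one]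
  · have hterm : ∀ i, C i ⊗ₖ D i = ((C i).trace * (D i).trace) • (σ i ⊗ₖ τ i) := fun i => by
      conv_lhs => rw [hCσ i, hDτ i]
      rw [Matrix.smul_kronecker, Matrix.kronecker_smul, smul_smul]
    simp only [hre, mul_smul (R.trace⁻¹), ← Finset.smul_sum, ← hterm, ← hRCD]
  · rw [smul_smul, mul_inv_cancel₀ hpos.ne', one_smul]

/-- If the Hilbert–Schmidt adjoint of the uniform noise map `Λ` sends
separable positive semidefinite operators to separable positive semidefinite operators,
then the noisy MDI nonlinear witness value is a nonnegative real number. -/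
theorem mdinew_uniform_noise_nonneg
    {α β : Type*} [Fintype α] [DecidableEq α] [Nonempty α]
    [Fintype β] [DecidableEq β] [Nonempty β]
    (W H₁ H₂ : Matrix (α × β) (α × β) ℂ) (sX : ℝ)
    (hW : W.IsHermitian) (hH₁ : H₁.IsHermitian) (hH₂ : H₂.IsHermitian) (hsX : 0 < sX)
    (hNEW : ∀ Q : Matrix (α × β) (α × β) ℂ, IsSepDensity Q →
      0 ≤ (W * Q).trace - (1 / (sX : ℂ)) * (((H₁ * Q).trace) ^ 2 + ((H₂ * Q).trace) ^ 2))
    {I : Type*} [Fintype I] (p : I → ℝ) (A : I → Matrix α α ℂ) (B : I → Matrix β β ℂ)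
    (hp : ∀ i, 0 ≤ p i) (hA : ∀ i, (A i).PosSemidef) (hB : ∀ i, (B i).PosSemidef)
    (G : Matrix (α × β) (α × β) ℂ) (hG : G = ∑ i, (p i : ℂ) • (A i ⊗ₖ B i))
    (Λ Λa : Matrix (α × β) (α × β) ℂ →ₗ[ℂ] Matrix (α × β) (α × β) ℂ)
    (hΛa : IsHSAdjoint Λ Λa)
    (hΛsep : ∀ ρ : Matrix (α × β) (α × β) ℂ, IsSepPSD ρ → IsSepPSD (Λa ρ))
    {S T : Type*} [Fintype S] [Fintype T]
    (τ : S → Matrix α α ℂ) (ω : T → Matrix β β ℂ)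
    (hτ : ∀ s, IsDensity (τ s)) (hω : ∀ t, IsDensity (ω t))
    (a b c : S → T → ℝ)
    (hWd : W = ∑ s, ∑ t, (a s t : ℂ) • ((τ s)ᵀ ⊗ₖ (ω t)ᵀ))
    (hH₁d : H₁ = ∑ s, ∑ t, (b s t : ℂ) • ((τ s)ᵀ ⊗ₖ (ω t)ᵀ))
    (hH₂d : H₂ = ∑ s, ∑ t, (c s t : ℂ) • ((τ s)ᵀ ⊗ₖ (ω t)ᵀ))
    (hpos : 0 < (G * Λ 1).trace) :
    0 ≤ (∑ s, ∑ t, (a s t : ℂ) * (G * Λ ((τ s)ᵀ ⊗ₖ (ω t)ᵀ)).trace)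
      - (1 / ((sX : ℂ) * (G * Λ 1).trace)) *
        ((∑ s, ∑ t, (b s t : ℂ) * (G * Λ ((τ s)ᵀ ⊗ₖ (ω t)ᵀ)).trace) ^ 2
          + (∑ s, ∑ t, (c s t : ℂ) * (G * Λ ((τ s)ᵀ ⊗ₖ (ω t)ᵀ)).trace) ^ 2) := by
  have hGsep : IsSepPSD G := by
    simp only [hG, ← Matrix.smul_kronecker]
    exact isSepPSD_sum_kronecker
      (fun i => (hA i).smul (Complex.zero_le_real.2 (hp i))) hB
  have hk : (G * Λ 1).trace = (Λa G).trace := by rw [hΛa, Matrix.mul_one]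
  rw [hk] at hpos ⊢
  obtain ⟨Q, hQ, hΛQ⟩ := (hΛsep G hGsep).exists_eq_trace_smul_sepDensity hpos
  have hval : ∀ f : S → T → ℝ,
      ∑ s, ∑ t, (f s t : ℂ) * (G * Λ ((τ s)ᵀ ⊗ₖ (ω t)ᵀ)).trace =
        (Λa G).trace * ((∑ s, ∑ t, (f s t : ℂ) • ((τ s)ᵀ ⊗ₖ (ω t)ᵀ)) * Q).trace := fun f => by
    calc _ = (Λa G * ∑ s, ∑ t, (f s t : ℂ) • ((τ s)ᵀ ⊗ₖ (ω t)ᵀ)).trace := by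
          simp only [hΛa G, Matrix.mul_sum, Matrix.trace_sum, Matrix.mul_smul, Matrix.trace_smul,
            smul_eq_mul]
      _ = _ := by
          conv_lhs => rw [hΛQ]
          rw [Matrix.smul_mul, Matrix.trace_smul, smul_eq_mul, Matrix.trace_mul_comm Q]
  rw [hval a, hval b, hval c, ← hWd, ← hH₁d, ← hH₂d]
  have hs : (sX : ℂ) ≠ 0 := Complex.ofReal_ne_zero.2 hsX.ne'
  have hk0 := hpos.ne'
  convert mul_nonneg hpos.le (hNEW Q hQ) using 1
  field_simp

end
end

section
/- Let α and β be nonempty finite types. Let (W, H₁, H₂, s) be a nonlinear entanglement witness on α × β, with decompositions τ_s, ω_t, α_{st}, β_{st}, γ_{st} as in the decomposition assumption. Let G = Σ_{i∈I} p_i A_i ⊗ B_i be a finite sum with p_i ≥ 0 and A_i, B_i positive semidefinite. Let Λ₁ be a linear map on matrices indexed by α and Λ₂ a linear map on matrices indexed by β whose Hilbert–Schmidt adjoints Λ₁⁺ and Λ₂⁺ each map positive semidefinite matrices to positive semidefinite matrices, and let Λ be a linear map on matrices indexed by α × β satisfying Λ(A ⊗ B) = Λ₁(A) ⊗ Λ₂(B)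 for all matrices A indexed by α and B indexed by β (local uniform noise). Assume tr(G·Λ(1)) > 0. Then N^Λ := Σ_{s,t} α_{st}·tr(G·Λ(τ_s^T ⊗ ω_t^T)) − (1/(s·tr(G·Λ(1))))·[(Σ_{s,t} β_{st}·tr(G·Λ(τ_s^T ⊗ ω_t^T)))² + (Σ_{s,t} γ_{st}·tr(G·Λ(τ_s^T ⊗ ω_t^T)))²] is a nonnegative real number. -/
open Matrix Kronecker BigOperators ComplexOrder

noncomputable section

theorem Matrix.PosSemidef.exists_isDensity_smul {n : Type*} [Fintype n] [DecidableEq n]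
    [Nonempty n] {C : Matrix n n ℂ} (hC : C.PosSemidef) :
    ∃ (r : ℝ) (σ : Matrix n n ℂ), 0 ≤ r ∧ IsDensity σ ∧ C = (r : ℂ) • σ := by
  by_cases h : C.trace = 0
  · have hcard : (Fintype.card n : ℂ) ≠ 0 := Nat.cast_ne_zero.mpr Fintype.card_ne_zero
    refine ⟨0, (Fintype.card n : ℂ)⁻¹ • 1, le_rfl, ⟨?_, ?_⟩, ?_⟩
    · exact PosSemidef.one.smul (inv_nonneg.mpr (Nat.cast_nonneg _))
    · rw [trace_smul, trace_one, smul_eq_mul, inv_mul_cancel₀ hcard]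
    · simp [hC.trace_eq_zero_iff.mp h]
  · have hre : ((C.trace.re : ℝ) : ℂ) = C.trace :=
      (Complex.eq_re_of_ofReal_le hC.trace_nonneg).symm
    refine ⟨C.trace.re, C.trace⁻¹ • C, (Complex.le_def.mp hC.trace_nonneg).1, ⟨?_, ?_⟩, ?_⟩
    · exact hC.smul (inv_nonneg.mpr hC.trace_nonneg)
    · rw [trace_smul, smul_eq_mul, inv_mul_cancel₀ h]
    · rw [hre, smul_smul, mul_inv_cancel₀ h, one_smul]

theorem isSepDensity_sum_kronecker {α β I : Type*} [Fintype α] [DecidableEq α] [Nonempty α]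
    [Fintype β] [DecidableEq β] [Nonempty β] [Fintype I] {p : I → ℝ}
    {C : I → Matrix α α ℂ} {D : I → Matrix β β ℂ} (hp : ∀ i, 0 ≤ p i)
    (hC : ∀ i, (C i).PosSemidef) (hD : ∀ i, (D i).PosSemidef)
    (htr : (∑ i, (p i : ℂ) • (C i ⊗ₖ D i)).trace = 1) :
    IsSepDensity (∑ i, (p i : ℂ) • (C i ⊗ₖ D i)) := by
  choose r σ hr hσ hCσ using fun i => (hC i).exists_isDensity_smul
  choose q υ hq hυ hDυ using fun i => (hD i).exists_isDensity_smul
  have hterm (i : I) : (p i : ℂ) • (C i ⊗ₖ D i) =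
      ((p i * r i * q i : ℝ) : ℂ) • (σ i ⊗ₖ υ i) := by
    rw [hCσ i, hDυ i, smul_kronecker, kronecker_smul, smul_smul, smul_smul]
    push_cast
    rw [mul_assoc]
  let e := (Fintype.equivFin I).symm
  refine ⟨Fintype.card I, fun k => p (e k) * r (e k) * q (e k), fun k => σ (e k),
    fun k => υ (e k), fun k => mul_nonneg (mul_nonneg (hp _) (hr _)) (hq _), ?_,
    fun k => hσ _, fun k => hυ _, ?_⟩
  · rw [e.sum_comp fun i => p i * r i * q i]
    simp only [hterm, trace_sum, trace_smul, trace_kronecker, (hσ _).2, (hυ _).2, smul_eq_mul,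
      mul_one] at htr
    exact_mod_cast htr
  · rw [e.sum_comp fun i => ((p i * r i * q i : ℝ) : ℂ) • (σ i ⊗ₖ υ i)]
    exact Finset.sum_congr rfl fun i _ => hterm i

theorem trace_sum_kronecker_mul_local {α β I : Type*} [Fintype α] [Fintype β] [Fintype I]
    (p : I → ℂ) (A : I → Matrix α α ℂ) (B : I → Matrix β β ℂ)
    {Λ₁ Λ₁a : Matrix α α ℂ →ₗ[ℂ] Matrix α α ℂ} {Λ₂ Λ₂a : Matrix β β ℂ →ₗ[ℂ] Matrix β β ℂ}
    (h₁ : IsHSAdjoint Λ₁ Λ₁a) (h₂ : IsHSAdjoint Λ₂ Λ₂a)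
    (M : Matrix α α ℂ) (N : Matrix β β ℂ) :
    ((∑ i, p i • (A i ⊗ₖ B i)) * (Λ₁ M ⊗ₖ Λ₂ N)).trace =
      ((M ⊗ₖ N) * ∑ i, p i • (Λ₁a (A i) ⊗ₖ Λ₂a (B i))).trace := by
  rw [trace_mul_comm (M ⊗ₖ N)]
  simp only [Finset.sum_mul, trace_sum, smul_mul, trace_smul, ← mul_kronecker_mul,
    trace_kronecker, h₁ _ M, h₂ _ N]

/-- Under local uniform noise `Λ = Λ₁ ⊗ Λ₂` whose local Hilbert–Schmidt
adjoints preserve positive semidefiniteness, the noisy MDI nonlinear witness value is a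
nonnegative real number. -/
theorem mdinew_local_uniform_noise_nonneg
    {α β : Type*} [Fintype α] [DecidableEq α] [Nonempty α]
    [Fintype β] [DecidableEq β] [Nonempty β]
    (W H₁ H₂ : Matrix (α × β) (α × β) ℂ) (sX : ℝ)
    (hW : W.IsHermitian) (hH₁ : H₁.IsHermitian) (hH₂ : H₂.IsHermitian) (hsX : 0 < sX)
    (hNEW : ∀ Q : Matrix (α × β) (α × β) ℂ, IsSepDensity Q →
      0 ≤ (W * Q).trace - (1 / (sX : ℂ)) * (((H₁ * Q).trace) ^ 2 + ((H₂ * Q).trace) ^ 2))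
    {I : Type*} [Fintype I] (p : I → ℝ) (A : I → Matrix α α ℂ) (B : I → Matrix β β ℂ)
    (hp : ∀ i, 0 ≤ p i) (hA : ∀ i, (A i).PosSemidef) (hB : ∀ i, (B i).PosSemidef)
    (G : Matrix (α × β) (α × β) ℂ) (hG : G = ∑ i, (p i : ℂ) • (A i ⊗ₖ B i))
    (Λ₁ Λ₁a : Matrix α α ℂ →ₗ[ℂ] Matrix α α ℂ)
    (Λ₂ Λ₂a : Matrix β β ℂ →ₗ[ℂ] Matrix β β ℂ)
    (hΛ₁a : IsHSAdjoint Λ₁ Λ₁a) (hΛ₂a : IsHSAdjoint Λ₂ Λ₂a)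
    (hΛ₁pos : ∀ M : Matrix α α ℂ, M.PosSemidef → (Λ₁a M).PosSemidef)
    (hΛ₂pos : ∀ M : Matrix β β ℂ, M.PosSemidef → (Λ₂a M).PosSemidef)
    (Λ : Matrix (α × β) (α × β) ℂ →ₗ[ℂ] Matrix (α × β) (α × β) ℂ)
    (hloc : ∀ (M : Matrix α α ℂ) (N : Matrix β β ℂ), Λ (M ⊗ₖ N) = Λ₁ M ⊗ₖ Λ₂ N)
    {S T : Type*} [Fintype S] [Fintype T]
    (τ : S → Matrix α α ℂ) (ω : T → Matrix β β ℂ)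
    (hτ : ∀ s, IsDensity (τ s)) (hω : ∀ t, IsDensity (ω t))
    (a b c : S → T → ℝ)
    (hWd : W = ∑ s, ∑ t, (a s t : ℂ) • ((τ s)ᵀ ⊗ₖ (ω t)ᵀ))
    (hH₁d : H₁ = ∑ s, ∑ t, (b s t : ℂ) • ((τ s)ᵀ ⊗ₖ (ω t)ᵀ))
    (hH₂d : H₂ = ∑ s, ∑ t, (c s t : ℂ) • ((τ s)ᵀ ⊗ₖ (ω t)ᵀ))
    (hpos : 0 < (G * Λ 1).trace) :
    0 ≤ (∑ s, ∑ t, (a s t : ℂ) * (G * Λ ((τ s)ᵀ ⊗ₖ (ω t)ᵀ)).trace)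
      - (1 / ((sX : ℂ) * (G * Λ 1).trace)) *
        ((∑ s, ∑ t, (b s t : ℂ) * (G * Λ ((τ s)ᵀ ⊗ₖ (ω t)ᵀ)).trace) ^ 2
          + (∑ s, ∑ t, (c s t : ℂ) * (G * Λ ((τ s)ᵀ ⊗ₖ (ω t)ᵀ)).trace) ^ 2) := by
  set t := (G * Λ 1).trace with ht
  set R : Matrix (α × β) (α × β) ℂ := ∑ i, (p i : ℂ) • (Λ₁a (A i) ⊗ₖ Λ₂a (B i)) with hR
  have key (M : Matrix α α ℂ) (N : Matrix β β ℂ) :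
      (G * Λ (M ⊗ₖ N)).trace = ((M ⊗ₖ N) * R).trace := by
    rw [hloc, hG]
    exact trace_sum_kronecker_mul_local _ A B hΛ₁a hΛ₂a M N
  have htR : R.trace = t := by
    rw [ht, ← one_kronecker_one, key, one_kronecker_one, one_mul]
  have hlin (f : S → T → ℝ) :
      ∑ s, ∑ u, (f s u : ℂ) * (G * Λ ((τ s)ᵀ ⊗ₖ (ω u)ᵀ)).trace =
        ((∑ s, ∑ u, (f s u : ℂ) • ((τ s)ᵀ ⊗ₖ (ω u)ᵀ)) * R).trace := by
    simp only [key, Finset.sum_mul, trace_sum, smul_mul, trace_smul, smul_eq_mul]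
  rw [hlin, hlin, hlin, ← hWd, ← hH₁d, ← hH₂d]
  have ht0 : t ≠ 0 := hpos.ne'
  have hs0 : (sX : ℂ) ≠ 0 := Complex.ofReal_ne_zero.mpr hsX.ne'
  have hsmul : t⁻¹ • R = ∑ i, (p i : ℂ) • ((t⁻¹ • Λ₁a (A i)) ⊗ₖ Λ₂a (B i)) := by
    simp only [hR, Finset.smul_sum, smul_kronecker, smul_comm t⁻¹]
  have hsep : IsSepDensity (t⁻¹ • R) := by
    rw [hsmul]
    refine isSepDensity_sum_kronecker hp
      (fun i => (hΛ₁pos _ (hA i)).smul (inv_nonneg.mpr hpos.le)) (fun i => hΛ₂pos _ (hB i)) ?_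
    rw [← hsmul, trace_smul, htR, smul_eq_mul, inv_mul_cancel₀ ht0]
  have h := mul_nonneg hpos.le (hNEW _ hsep)
  simp only [Matrix.mul_smul, trace_smul, smul_eq_mul] at h
  convert h using 1
  field_simp

end
end

section
/- Let α and β be nonempty finite types, Λ₁ a linear map on complex matrices indexed by α, Λ₂ a linear map on complex matrices indexed by β, and Λ a linear map on complex matrices indexed by α × β satisfying Λ(A ⊗ B) = Λ₁(A) ⊗ Λ₂(B) for all matrices A indexed by α and B indexed by β. Then (i) the Hilbert–Schmidt adjoint of Λ satisfies Λ⁺(A ⊗ B) = Λ₁⁺(A) ⊗ Λ₂⁺(B) for all A, B; and (ii) if Λ₁⁺ and Λ₂⁺ each map positive semidefinite matrices to positive semidefinite matrices, then Λ⁺ maps every separable positive semidefinite operator indexed by α × β to a separable positive semidefinite operator. -/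
open Matrix Kronecker BigOperators ComplexOrder

noncomputable section

/-- Matrices on a product index type are separated by their trace pairings with Kronecker
products. -/
theorem ext_of_trace_mul_kronecker {R α β : Type*} [NonAssocSemiring R] [Fintype α] [Fintype β]
    {X Y : Matrix (α × β) (α × β) R}
    (h : ∀ (A : Matrix α α R) (B : Matrix β β R),
      (X * (A ⊗ₖ B)).trace = (Y * (A ⊗ₖ B)).trace) : X = Y := by
  classical
  ext ⟨i, k⟩ ⟨j, l⟩
  simpa [single_kronecker_single, trace_mul_single] using h (single j i 1) (single l k 1)

/-- The Hilbert–Schmidt adjoint of a map acting factorwise on Kronecker products acts factorwise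
through the adjoints of the factors. -/
theorem IsHSAdjoint.map_kronecker {α β : Type*} [Fintype α] [Fintype β]
    {Λ₁ Λ₁a : Matrix α α ℂ →ₗ[ℂ] Matrix α α ℂ} {Λ₂ Λ₂a : Matrix β β ℂ →ₗ[ℂ] Matrix β β ℂ}
    {Λ Λa : Matrix (α × β) (α × β) ℂ →ₗ[ℂ] Matrix (α × β) (α × β) ℂ}
    (hΛa : IsHSAdjoint Λ Λa) (hΛ₁a : IsHSAdjoint Λ₁ Λ₁a) (hΛ₂a : IsHSAdjoint Λ₂ Λ₂a)
    (hloc : ∀ (A : Matrix α α ℂ) (B : Matrix β β ℂ), Λ (A ⊗ₖ B) = Λ₁ A ⊗ₖ Λ₂ B)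
    (A : Matrix α α ℂ) (B : Matrix β β ℂ) : Λa (A ⊗ₖ B) = Λ₁a A ⊗ₖ Λ₂a B := by
  refine ext_of_trace_mul_kronecker fun C D => ?_
  rw [← hΛa, hloc, ← mul_kronecker_mul, ← mul_kronecker_mul, trace_kronecker, trace_kronecker,
    hΛ₁a, hΛ₂a]

/-- A linear map that acts factorwise on Kronecker products through positive maps preserves
separability. -/
theorem IsSepPSD.map {α β : Type*} [Fintype α] [Fintype β] {ρ : Matrix (α × β) (α × β) ℂ}
    (hρ : IsSepPSD ρ)
    {Φ₁ : Matrix α α ℂ →ₗ[ℂ] Matrix α α ℂ} {Φ₂ : Matrix β β ℂ →ₗ[ℂ] Matrix β β ℂ}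
    {Φ : Matrix (α × β) (α × β) ℂ →ₗ[ℂ] Matrix (α × β) (α × β) ℂ}
    (hloc : ∀ (A : Matrix α α ℂ) (B : Matrix β β ℂ), Φ (A ⊗ₖ B) = Φ₁ A ⊗ₖ Φ₂ B)
    (h₁ : ∀ M : Matrix α α ℂ, M.PosSemidef → (Φ₁ M).PosSemidef)
    (h₂ : ∀ N : Matrix β β ℂ, N.PosSemidef → (Φ₂ N).PosSemidef) : IsSepPSD (Φ ρ) := by
  obtain ⟨m, C, D, hC, hD, rfl⟩ := hρ
  exact ⟨m, fun i => Φ₁ (C i), fun i => Φ₂ (D i), fun i => h₁ _ (hC i), fun i => h₂ _ (hD i),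
    by simp only [map_sum, hloc]⟩

/-- The Hilbert–Schmidt adjoint of a local map `Λ = Λ₁ ⊗ Λ₂` is
`Λ₁⁺ ⊗ Λ₂⁺`, and if `Λ₁⁺`, `Λ₂⁺` preserve positive semidefiniteness then `Λ⁺` maps
separable positive semidefinite operators to separable positive semidefinite operators. -/
theorem hs_adjoint_of_local_map
    {α β : Type*} [Fintype α] [DecidableEq α] [Nonempty α]
    [Fintype β] [DecidableEq β] [Nonempty β]
    (Λ₁ Λ₁a : Matrix α α ℂ →ₗ[ℂ] Matrix α α ℂ)
    (Λ₂ Λ₂a : Matrix β β ℂ →ₗ[ℂ] Matrix β β ℂ)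
    (Λ Λa : Matrix (α × β) (α × β) ℂ →ₗ[ℂ] Matrix (α × β) (α × β) ℂ)
    (hΛ₁a : IsHSAdjoint Λ₁ Λ₁a) (hΛ₂a : IsHSAdjoint Λ₂ Λ₂a) (hΛa : IsHSAdjoint Λ Λa)
    (hloc : ∀ (A : Matrix α α ℂ) (B : Matrix β β ℂ), Λ (A ⊗ₖ B) = Λ₁ A ⊗ₖ Λ₂ B) :
    (∀ (A : Matrix α α ℂ) (B : Matrix β β ℂ), Λa (A ⊗ₖ B) = Λ₁a A ⊗ₖ Λ₂a B) ∧
    ((∀ M : Matrix α α ℂ, M.PosSemidef → (Λ₁a M).PosSemidef) →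
      (∀ N : Matrix β β ℂ, N.PosSemidef → (Λ₂a N).PosSemidef) →
      ∀ ρ : Matrix (α × β) (α × β) ℂ, IsSepPSD ρ → IsSepPSD (Λa ρ)) := by
  have h := hΛa.map_kronecker hΛ₁a hΛ₂a hloc
  exact ⟨h, fun h₁ h₂ _ hρ => hρ.map h h₁ h₂⟩

end
end

section
/- (Measurement-device independence of the nonlinear witness.) Let α and β be nonempty finite types with cardinalities d_A and d_B. Let (W, H₁, H₂, s) be a nonlinear entanglement witness on α × β, with decompositions τ_s, ω_t, α_{st}, β_{st}, γ_{st} as in the decomposition assumption. Let σ be a separable density matrix indexed by α × β, and let A₁ (indexed by α × α) and B₁ (indexed by β × β) be positive semidefinite matrices (arbitrary dichotomic POVM elements). Define the real outcome probabilities P^{st} = tr((A₁ ⊗ B₁)·M(τ_s, σ, ω_t)) for s ∈ S, t ∈ T, and P^{AB} = tr((A₁ ⊗ B₁)·M((1/d_A)·1_α, σ, (1/d_B)·1_β)), and assume P^{AB} > 0. Then the MDI nonlinear witness value N := Σ_{s,t} α_{st}·P^{st} − (1/(s·d_A·d_B·P^{AB}))·[(Σ_{s,t} β_{st}·P^{st})²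 + (Σ_{s,t} γ_{st}·P^{st})²] is nonnegative. -/
open Matrix Kronecker BigOperators ComplexOrder

noncomputable section

/-- Contracting the second factor of a positive semidefinite matrix with a positive semidefinite
matrix yields a positive semidefinite matrix that represents the functional
`τ ↦ tr (A (τ ⊗ ρ))`. -/
lemma exists_posSemidef_trace_mul_kronecker {γ δ : Type*} [Fintype γ] [DecidableEq γ]
    [Fintype δ] [DecidableEq δ] {A : Matrix (γ × δ) (γ × δ) ℂ} (hA : A.PosSemidef)
    {ρ : Matrix δ δ ℂ} (hρ : ρ.PosSemidef) :
    ∃ X : Matrix γ γ ℂ, X.PosSemidef ∧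
      ∀ τ : Matrix γ γ ℂ, (A * (τ ⊗ₖ ρ)).trace = (τᵀ * X).trace := by
  obtain ⟨B, rfl⟩ : ∃ B : Matrix δ δ ℂ, ρ = Bᴴ * B := by
    open scoped MatrixOrder in
    exact CStarAlgebra.nonneg_iff_eq_star_mul_self.mp hρ.nonneg
  let V : δ → Matrix γ (γ × δ) ℂ := fun k => Matrix.of fun a x => if a = x.1 then B k x.2 else 0
  refine ⟨(∑ k, V k * A * (V k)ᴴ)ᵀ,
    (Matrix.posSemidef_sum _ fun k _ => hA.mul_mul_conjTranspose_same (V k)).transpose,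
    fun τ => ?_⟩
  have hV (k : δ) (a a' : γ) : (V k * A * (V k)ᴴ) a a' =
      ∑ d', ∑ d, B k d * A (a, d) (a', d') * star (B k d') := by
    simp [V, Matrix.mul_apply, Fintype.sum_prod_type, apply_ite, Finset.sum_mul, ite_mul,
      Finset.sum_ite_irrel]
  rw [← Matrix.transpose_mul, Matrix.trace_transpose]
  simp only [Matrix.trace, Matrix.diag_apply, Matrix.mul_apply, Matrix.sum_apply, hV,
    Fintype.sum_prod_type, Matrix.kroneckerMap_apply, Matrix.conjTranspose_apply,
    Finset.sum_mul, Finset.mul_sum]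
  refine Finset.sum_congr rfl fun a _ => ?_
  refine Finset.sum_comm.trans (Eq.trans (Finset.sum_congr rfl fun a' _ => ?_) Finset.sum_comm)
  refine Finset.sum_comm.trans (Eq.trans (Finset.sum_congr rfl fun d' _ => ?_) Finset.sum_comm)
  refine Finset.sum_comm.trans
    (Finset.sum_congr rfl fun k _ => Finset.sum_congr rfl fun d _ => ?_)
  ring

/-- The analogue of `exists_posSemidef_trace_mul_kronecker` for contraction of the first factor. -/
lemma exists_posSemidef_trace_mul_kronecker_left {γ δ : Type*} [Fintype γ] [DecidableEq γ]
    [Fintype δ] [DecidableEq δ] {A : Matrix (δ × γ) (δ × γ) ℂ} (hA : A.PosSemidef)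
    {ρ : Matrix δ δ ℂ} (hρ : ρ.PosSemidef) :
    ∃ X : Matrix γ γ ℂ, X.PosSemidef ∧
      ∀ τ : Matrix γ γ ℂ, (A * (ρ ⊗ₖ τ)).trace = (τᵀ * X).trace := by
  obtain ⟨X, hX, h⟩ :=
    exists_posSemidef_trace_mul_kronecker (hA.submatrix (Prod.swap : γ × δ → δ × γ)) hρ
  refine ⟨X, hX, fun τ => ?_⟩
  rw [← h τ]
  simp only [Matrix.trace, Matrix.diag_apply, Matrix.mul_apply, Matrix.submatrix_apply]
  refine (Fintype.sum_equiv (Equiv.prodComm γ δ) _ _ fun x => ?_).symm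
  refine Fintype.sum_equiv (Equiv.prodComm γ δ) _ _ fun y => ?_
  simp [mul_comm]

lemma Matrix.PosSemidef.exists_eq_smul_isDensity {n : Type*} [Fintype n] [Nonempty n]
    {C : Matrix n n ℂ} (hC : C.PosSemidef) :
    ∃ (q : ℝ) (ρ : Matrix n n ℂ), 0 ≤ q ∧ IsDensity ρ ∧ C = (q : ℂ) • ρ := by
  classical
  obtain ⟨q, hq, hqC⟩ := RCLike.nonneg_iff_exists_ofReal.mp hC.trace_nonneg
  replace hqC : (q : ℂ) = C.trace := hqC
  by_cases h : C.trace = 0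
  · refine ⟨0, ((Fintype.card n : ℂ))⁻¹ • 1, le_rfl,
      ⟨Matrix.PosSemidef.one.smul (by positivity), ?_⟩, ?_⟩
    · simp
    · simpa using hC.trace_eq_zero_iff.mp h
  · refine ⟨q, (q : ℂ)⁻¹ • C, hq, ⟨hC.smul ?_, ?_⟩, ?_⟩
    · exact inv_nonneg.mpr (by exact_mod_cast hq)
    · simp [hqC, h]
    · rw [smul_smul, hqC, mul_inv_cancel₀ h, one_smul]

lemma IsSepPSD.isSepDensity {α β : Type*} [Fintype α] [Nonempty α] [Fintype β] [Nonempty β]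
    {Q : Matrix (α × β) (α × β) ℂ} (hQ : IsSepPSD Q) (htr : Q.trace = 1) : IsSepDensity Q := by
  obtain ⟨m, C, D, hC, hD, rfl⟩ := hQ
  choose q ρ hq hρ hCρ using fun i => (hC i).exists_eq_smul_isDensity
  choose r η hr hη hDη using fun i => (hD i).exists_eq_smul_isDensity
  have hCD (i : Fin m) : C i ⊗ₖ D i = ((q i * r i : ℝ) : ℂ) • (ρ i ⊗ₖ η i) := by
    rw [hCρ i, hDη i, Matrix.smul_kronecker, Matrix.kronecker_smul, smul_smul]
    push_cast
    rfl
  refine ⟨m, fun i => q i * r i, ρ, η, fun i => mul_nonneg (hq i) (hr i), ?_, hρ, hη,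
    Finset.sum_congr rfl fun i _ => hCD i⟩
  simp only [hCD, Matrix.trace_sum, Matrix.trace_smul, Matrix.trace_kronecker, (hρ _).2,
    (hη _).2, smul_eq_mul, mul_one] at htr
  exact_mod_cast htr

lemma IsSepDensity.isSepPSD {α β : Type*} [Fintype α] [Fintype β]
    {ρ : Matrix (α × β) (α × β) ℂ} (hρ : IsSepDensity ρ) : IsSepPSD ρ := by
  obtain ⟨m, p, σA, σB, hp, -, hA, hB, rfl⟩ := hρ
  refine ⟨m, fun i => (p i : ℂ) • σA i, σB, fun i => (hA i).1.smul ?_, fun i => (hB i).1, ?_⟩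
  · exact_mod_cast hp i
  · simp only [Matrix.smul_kronecker]

lemma IsSepPSD.smul {α β : Type*} [Fintype α] [Fintype β]
    {ρ : Matrix (α × β) (α × β) ℂ} (hρ : IsSepPSD ρ) {k : ℂ} (hk : 0 ≤ k) :
    IsSepPSD (k • ρ) := by
  obtain ⟨m, C, D, hC, hD, rfl⟩ := hρ
  refine ⟨m, fun i => k • C i, D, fun i => (hC i).smul hk, hD, ?_⟩
  simp only [Matrix.smul_kronecker, Finset.smul_sum]

lemma Mop_sum_kronecker {α β ι : Type*} (s : Finset ι)
    (τ : Matrix α α ℂ) (C : ι → Matrix α α ℂ) (D : ι → Matrix β β ℂ) (ω : Matrix β β ℂ) :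
    Mop τ (∑ i ∈ s, C i ⊗ₖ D i) ω = ∑ i ∈ s, (τ ⊗ₖ C i) ⊗ₖ (D i ⊗ₖ ω) := by
  ext x y
  simp only [Mop, Matrix.of_apply, Matrix.sum_apply, Matrix.kroneckerMap_apply, Finset.mul_sum,
    Finset.sum_mul]
  exact Finset.sum_congr rfl fun i _ => by ring

/-- The outcome statistics on a separable operator are those of an effective separable operator
on the input spaces. -/
lemma IsSepPSD.exists_effective {α β : Type*} [Fintype α] [DecidableEq α]
    [Fintype β] [DecidableEq β] {ρ : Matrix (α × β) (α × β) ℂ} (hρ : IsSepPSD ρ)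
    {A : Matrix (α × α) (α × α) ℂ} {B : Matrix (β × β) (β × β) ℂ}
    (hA : A.PosSemidef) (hB : B.PosSemidef) :
    ∃ R : Matrix (α × β) (α × β) ℂ, IsSepPSD R ∧ ∀ (τ : Matrix α α ℂ) (ω : Matrix β β ℂ),
      ((A ⊗ₖ B) * Mop τ ρ ω).trace = ((τᵀ ⊗ₖ ωᵀ) * R).trace := by
  obtain ⟨m, C, D, hC, hD, rfl⟩ := hρ
  choose X hX hAX using fun i => exists_posSemidef_trace_mul_kronecker hA (hC i)
  choose Y hY hBY using fun i => exists_posSemidef_trace_mul_kronecker_left hB (hD i)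
  refine ⟨∑ i, X i ⊗ₖ Y i, ⟨m, X, Y, hX, hY, rfl⟩, fun τ ω => ?_⟩
  simp only [Mop_sum_kronecker, Matrix.mul_sum, Matrix.trace_sum, ← Matrix.mul_kronecker_mul,
    Matrix.trace_kronecker, hAX, hBY]

/-- Measurement-device independence of the nonlinear witness: for any
separable shared state and any positive semidefinite POVM elements, the MDI nonlinear
witness value is nonnegative. -/
theorem mdinew_nonneg_on_separable
    {α β : Type*} [Fintype α] [DecidableEq α] [Nonempty α]
    [Fintype β] [DecidableEq β] [Nonempty β]
    (W H₁ H₂ : Matrix (α × β) (α × β) ℂ) (sX : ℝ)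
    (hW : W.IsHermitian) (hH₁ : H₁.IsHermitian) (hH₂ : H₂.IsHermitian) (hsX : 0 < sX)
    (hNEW : ∀ Q : Matrix (α × β) (α × β) ℂ, IsSepDensity Q →
      0 ≤ (W * Q).trace - (1 / (sX : ℂ)) * (((H₁ * Q).trace) ^ 2 + ((H₂ * Q).trace) ^ 2))
    {S T : Type*} [Fintype S] [Fintype T]
    (τ : S → Matrix α α ℂ) (ω : T → Matrix β β ℂ)
    (hτ : ∀ s, IsDensity (τ s)) (hω : ∀ t, IsDensity (ω t))
    (a b c : S → T → ℝ)
    (hWd : W = ∑ s, ∑ t, (a s t : ℂ) • ((τ s)ᵀ ⊗ₖ (ω t)ᵀ))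
    (hH₁d : H₁ = ∑ s, ∑ t, (b s t : ℂ) • ((τ s)ᵀ ⊗ₖ (ω t)ᵀ))
    (hH₂d : H₂ = ∑ s, ∑ t, (c s t : ℂ) • ((τ s)ᵀ ⊗ₖ (ω t)ᵀ))
    (σ : Matrix (α × β) (α × β) ℂ) (hσ : IsSepDensity σ)
    (A₁ : Matrix (α × α) (α × α) ℂ) (B₁ : Matrix (β × β) (β × β) ℂ)
    (hA₁ : A₁.PosSemidef) (hB₁ : B₁.PosSemidef)
    (PAB : ℂ)
    (hPAB : PAB = ((A₁ ⊗ₖ B₁) *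
      Mop (((Fintype.card α : ℂ))⁻¹ • (1 : Matrix α α ℂ)) σ
          (((Fintype.card β : ℂ))⁻¹ • (1 : Matrix β β ℂ))).trace)
    (hPABpos : 0 < PAB) :
    0 ≤ (∑ s, ∑ t, (a s t : ℂ) * ((A₁ ⊗ₖ B₁) * Mop (τ s) σ (ω t)).trace)
      - (1 / ((sX : ℂ) * (Fintype.card α : ℂ) * (Fintype.card β : ℂ) * PAB)) *
        ((∑ s, ∑ t, (b s t : ℂ) * ((A₁ ⊗ₖ B₁) * Mop (τ s) σ (ω t)).trace) ^ 2
          + (∑ s, ∑ t, (c s t : ℂ) * ((A₁ ⊗ₖ B₁) * Mop (τ s) σ (ω t)).trace) ^ 2) := by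
  obtain ⟨R, hR, hstat⟩ := hσ.isSepPSD.exists_effective hA₁ hB₁
  have htr (f : S → T → ℝ) :
      ((∑ s, ∑ t, (f s t : ℂ) • ((τ s)ᵀ ⊗ₖ (ω t)ᵀ)) * R).trace =
        ∑ s, ∑ t, (f s t : ℂ) * ((A₁ ⊗ₖ B₁) * Mop (τ s) σ (ω t)).trace := by
    simp only [hstat, Matrix.sum_mul, Matrix.trace_sum, Matrix.smul_mul, Matrix.trace_smul,
      smul_eq_mul]
  have hdA : (Fintype.card α : ℂ) ≠ 0 := Nat.cast_ne_zero.mpr Fintype.card_ne_zero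
  have hdB : (Fintype.card β : ℂ) ≠ 0 := Nat.cast_ne_zero.mpr Fintype.card_ne_zero
  have hRtr : R.trace = Fintype.card α * Fintype.card β * PAB := by
    rw [hPAB, hstat]
    simp only [Matrix.transpose_smul, Matrix.transpose_one, Matrix.smul_kronecker,
      Matrix.kronecker_smul, Matrix.one_kronecker_one, Matrix.smul_mul, Matrix.one_mul,
      Matrix.trace_smul, smul_eq_mul]
    field_simp
  have hRpos : 0 < R.trace := by
    rw [hRtr]
    have : 0 < Fintype.card α := Fintype.card_pos
    have : 0 < Fintype.card β := Fintype.card_pos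
    positivity
  have hR0 : R.trace ≠ 0 := hRpos.ne'
  have hQ : IsSepDensity ((R.trace)⁻¹ • R) :=
    (hR.smul (inv_nonneg.mpr hRpos.le)).isSepDensity (by simp [hR0])
  have hs0 : (sX : ℂ) ≠ 0 := Complex.ofReal_ne_zero.mpr hsX.ne'
  have key := mul_nonneg hRpos.le (hNEW _ hQ)
  rw [← htr a, ← htr b, ← htr c, ← hWd, ← hH₁d, ← hH₂d]
  have hden : (sX : ℂ) * Fintype.card α * Fintype.card β * PAB = sX * R.trace := by
    rw [hRtr]; ring
  rw [hden]
  convert key using 1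
  simp only [Matrix.mul_smul, Matrix.trace_smul, smul_eq_mul]
  field_simp

end
end

section
/- (Reduction to effective POVM elements.) Let α and β be nonempty finite types. Let σ = Σ_{i∈I} p_i σ_A^i ⊗ σ_B^i be a finite sum with real p_i and matrices σ_A^i indexed by α, σ_B^i indexed by β, and let A₁ be a matrix indexed by α × α and B₁ a matrix indexed by β × β. For each i define the effective operators Ã_i = (Tr₂(A₁·(1_α ⊗ σ_A^i)))^T (indexed by α) and B̃_i = (Tr₁(B₁·(σ_B^i ⊗ 1_β)))^T (indexed by β). Then for all matrices τ indexed by α and ω indexed by β: tr((A₁ ⊗ B₁)·M(τ, σ, ω)) = Σ_{i∈I} p_i · tr(Ã_i·τ^T) · tr(B̃_i·ω^T) = tr((Σ_{i∈I} p_i Ã_i ⊗ B̃_i)·(τ^T ⊗ ω^T)). -/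
open Matrix Kronecker BigOperators ComplexOrder

noncomputable section

/-- A trace against a partial trace over the second factor. -/
theorem trace_ptr2_mul {α β : Type*} [Fintype α] [Fintype β] [DecidableEq β]
    (X : Matrix (α × β) (α × β) ℂ) (τ : Matrix α α ℂ) :
    (ptr2 X * τ).trace = (X * (τ ⊗ₖ (1 : Matrix β β ℂ))).trace := by
  simp only [Matrix.trace, Matrix.diag_apply, Matrix.mul_apply, ptr2, Matrix.of_apply,
    Fintype.sum_prod_type, kroneckerMap_apply, Matrix.one_apply, mul_ite, mul_one, mul_zero,
    Finset.sum_ite_eq', Finset.mem_univ, if_true, Finset.sum_mul]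
  exact Finset.sum_congr rfl fun _ _ => Finset.sum_comm

/-- A trace against a partial trace over the first factor. -/
theorem trace_ptr1_mul {α β : Type*} [Fintype α] [DecidableEq α] [Fintype β]
    (X : Matrix (α × β) (α × β) ℂ) (ω : Matrix β β ℂ) :
    (ptr1 X * ω).trace = (X * ((1 : Matrix α α ℂ) ⊗ₖ ω)).trace := by
  simp only [Matrix.trace, Matrix.diag_apply, Matrix.mul_apply, ptr1, Matrix.of_apply,
    Fintype.sum_prod_type_right, kroneckerMap_apply, Matrix.one_apply, ite_mul, one_mul, zero_mul,
    mul_ite, mul_zero, Finset.sum_ite_eq', Finset.mem_univ, if_true, Finset.sum_mul]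
  exact Finset.sum_congr rfl fun _ _ => Finset.sum_comm

theorem trace_transpose_mul_transpose {n : Type*} [Fintype n] (X Y : Matrix n n ℂ) :
    (Xᵀ * Yᵀ).trace = (X * Y).trace := by
  rw [← Matrix.transpose_mul, Matrix.trace_transpose, Matrix.trace_mul_comm]

theorem trace_effective_left {α : Type*} [Fintype α] [DecidableEq α]
    (A : Matrix (α × α) (α × α) ℂ) (ρ τ : Matrix α α ℂ) :
    ((ptr2 (A * ((1 : Matrix α α ℂ) ⊗ₖ ρ)))ᵀ * τᵀ).trace = (A * (τ ⊗ₖ ρ)).trace := by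
  rw [trace_transpose_mul_transpose, trace_ptr2_mul, Matrix.mul_assoc,
    ← Matrix.mul_kronecker_mul, Matrix.one_mul, Matrix.mul_one]

theorem trace_effective_right {β : Type*} [Fintype β] [DecidableEq β]
    (B : Matrix (β × β) (β × β) ℂ) (ρ ω : Matrix β β ℂ) :
    ((ptr1 (B * (ρ ⊗ₖ (1 : Matrix β β ℂ))))ᵀ * ωᵀ).trace = (B * (ρ ⊗ₖ ω)).trace := by
  rw [trace_transpose_mul_transpose, trace_ptr1_mul, Matrix.mul_assoc,
    ← Matrix.mul_kronecker_mul, Matrix.one_mul, Matrix.mul_one]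

/-- On a combination of product operators, `Mop` is the same combination of products across the
Alice–Bob cut. -/
theorem Mop_sum_smul_kronecker {α β I : Type*} [Fintype I] (c : I → ℂ)
    (σA : I → Matrix α α ℂ) (σB : I → Matrix β β ℂ) (τ : Matrix α α ℂ) (ω : Matrix β β ℂ) :
    Mop τ (∑ i, c i • (σA i ⊗ₖ σB i)) ω = ∑ i, c i • ((τ ⊗ₖ σA i) ⊗ₖ (σB i ⊗ₖ ω)) := by
  ext x y
  simp only [Mop, Matrix.of_apply, Matrix.sum_apply, Matrix.smul_apply, kroneckerMap_apply,
    smul_eq_mul, Finset.mul_sum, Finset.sum_mul]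
  exact Finset.sum_congr rfl fun _ _ => by ring

/-- Reduction of the outcome probability to effective POVM elements. -/
theorem reduction_to_effective_povm
    {α β : Type*} [Fintype α] [DecidableEq α] [Nonempty α]
    [Fintype β] [DecidableEq β] [Nonempty β]
    {I : Type*} [Fintype I] (p : I → ℝ)
    (σA : I → Matrix α α ℂ) (σB : I → Matrix β β ℂ)
    (σ : Matrix (α × β) (α × β) ℂ) (hσ : σ = ∑ i, (p i : ℂ) • (σA i ⊗ₖ σB i))
    (A₁ : Matrix (α × α) (α × α) ℂ) (B₁ : Matrix (β × β) (β × β) ℂ)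
    (τ : Matrix α α ℂ) (ω : Matrix β β ℂ) :
    ((A₁ ⊗ₖ B₁) * Mop τ σ ω).trace
        = ∑ i, (p i : ℂ) * ((ptr2 (A₁ * ((1 : Matrix α α ℂ) ⊗ₖ σA i)))ᵀ * τᵀ).trace
            * ((ptr1 (B₁ * (σB i ⊗ₖ (1 : Matrix β β ℂ))))ᵀ * ωᵀ).trace ∧
    ((A₁ ⊗ₖ B₁) * Mop τ σ ω).trace
        = ((∑ i, (p i : ℂ) • ((ptr2 (A₁ * ((1 : Matrix α α ℂ) ⊗ₖ σA i)))ᵀ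
              ⊗ₖ (ptr1 (B₁ * (σB i ⊗ₖ (1 : Matrix β β ℂ))))ᵀ))
            * (τᵀ ⊗ₖ ωᵀ)).trace := by
  have h : ((A₁ ⊗ₖ B₁) * Mop τ σ ω).trace
      = ∑ i, (p i : ℂ) * ((ptr2 (A₁ * ((1 : Matrix α α ℂ) ⊗ₖ σA i)))ᵀ * τᵀ).trace
          * ((ptr1 (B₁ * (σB i ⊗ₖ (1 : Matrix β β ℂ))))ᵀ * ωᵀ).trace := by
    simp only [hσ, Mop_sum_smul_kronecker, trace_effective_left, trace_effective_right,
      Matrix.mul_sum, Matrix.trace_sum, Matrix.mul_smul, Matrix.trace_smul,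
      ← Matrix.mul_kronecker_mul, Matrix.trace_kronecker, smul_eq_mul, mul_assoc]
  refine ⟨h, h.trans ?_⟩
  simp only [Matrix.sum_mul, Matrix.trace_sum, Matrix.smul_mul, Matrix.trace_smul,
    ← Matrix.mul_kronecker_mul, Matrix.trace_kronecker, smul_eq_mul, mul_assoc]

end
end

section
/- (MDI-EW reduces to the standard EW for maximally entangled POVMs.) Let α and β be nonempty finite types with cardinalities d_A and d_B, and let Φ_A (indexed by α × α) and Φ_B (indexed by β × β) be the maximally entangled projectors, Φ_A[(i,i'),(j,j')] = (1/d_A)·δ_{i,i'}·δ_{j,j'} and Φ_B[(i,i'),(j,j')] = (1/d_B)·δ_{i,i'}·δ_{j,j'}. Then (i) for all matrices τ indexed by α, ρ indexed by α × β, and ω indexed by β: tr((Φ_A ⊗ Φ_B)·M(τ, ρ, ω)) = tr((τ^T ⊗ ω^T)·ρ)/(d_A·d_B); and (ii) if W = Σ_{s,t} α_{st}·τ_s^T ⊗ ω_t^T for a finite family of matrices τ_s indexed by α, ω_t indexed by β and real coefficients α_{st}, then for every matrix ρ indexed by α × β: Σ_{s,t} α_{st}·tr((Φ_A ⊗ Φ_B)·M(τ_s,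 ρ, ω_t)) = tr(W·ρ)/(d_A·d_B). -/
open Matrix Kronecker BigOperators ComplexOrder

noncomputable section

/-- The trace of a product against scaled maximally entangled projectors only sees the
diagonal indices of each pair. -/
theorem trace_maxEntangled_kronecker_mul
    {α β : Type*} [Fintype α] [DecidableEq α] [Fintype β] [DecidableEq β] (c d : ℂ)
    (M : Matrix ((α × α) × (β × β)) ((α × α) × (β × β)) ℂ) :
    (((Matrix.of fun x y : α × α => if x.1 = x.2 ∧ y.1 = y.2 then c else 0) ⊗ₖ
        (Matrix.of fun x y : β × β => if x.1 = x.2 ∧ y.1 = y.2 then d else 0)) * M).trace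
      = c * d * ∑ i, ∑ k, ∑ j, ∑ l, M ((j, j), (l, l)) ((i, i), (k, k)) := by
  simp only [Matrix.trace, Matrix.diag_apply, Matrix.mul_apply, Matrix.kroneckerMap_apply,
    Fintype.sum_prod_type]
  simp only [Matrix.of_apply]
  simp only [ite_and, ite_mul, mul_ite, zero_mul, mul_zero, Finset.sum_ite_irrel,
    Finset.sum_const_zero, Finset.sum_ite_eq, Finset.mem_univ, if_true, Finset.mul_sum]

theorem trace_maxEntangled_kronecker_mul_Mop
    {α β : Type*} [Fintype α] [DecidableEq α] [Fintype β] [DecidableEq β] (c d : ℂ)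
    (τ : Matrix α α ℂ) (ρ : Matrix (α × β) (α × β) ℂ) (ω : Matrix β β ℂ) :
    (((Matrix.of fun x y : α × α => if x.1 = x.2 ∧ y.1 = y.2 then c else 0) ⊗ₖ
        (Matrix.of fun x y : β × β => if x.1 = x.2 ∧ y.1 = y.2 then d else 0)) *
          Mop τ ρ ω).trace
      = c * d * ((τᵀ ⊗ₖ ωᵀ) * ρ).trace := by
  rw [trace_maxEntangled_kronecker_mul]
  simp only [Mop, Matrix.trace, Matrix.diag_apply, Matrix.mul_apply, Matrix.kroneckerMap_apply,
    Matrix.of_apply, Fintype.sum_prod_type, Matrix.transpose_apply, mul_right_comm]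

/-- With maximally entangled POVM elements, the MDI outcome probabilities
reduce to the standard expectation values, and the MDI-EW reduces to the standard EW. -/
theorem mdiew_reduces_to_ew
    {α β : Type*} [Fintype α] [DecidableEq α] [Nonempty α]
    [Fintype β] [DecidableEq β] [Nonempty β]
    (ΦA : Matrix (α × α) (α × α) ℂ) (ΦB : Matrix (β × β) (β × β) ℂ)
    (hΦA : ΦA = Matrix.of (fun x y : α × α =>
        if x.1 = x.2 ∧ y.1 = y.2 then (1 / (Fintype.card α : ℂ)) else 0))
    (hΦB : ΦB = Matrix.of (fun x y : β × β =>
        if x.1 = x.2 ∧ y.1 = y.2 then (1 / (Fintype.card β : ℂ)) else 0)) :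
    (∀ (τ : Matrix α α ℂ) (ρ : Matrix (α × β) (α × β) ℂ) (ω : Matrix β β ℂ),
      ((ΦA ⊗ₖ ΦB) * Mop τ ρ ω).trace
        = ((τᵀ ⊗ₖ ωᵀ) * ρ).trace / ((Fintype.card α : ℂ) * (Fintype.card β : ℂ))) ∧
    (∀ (S T : Type) (_ : Fintype S) (_ : Fintype T)
      (τs : S → Matrix α α ℂ) (ωt : T → Matrix β β ℂ) (a : S → T → ℝ)
      (W : Matrix (α × β) (α × β) ℂ),
      W = ∑ s, ∑ t, (a s t : ℂ) • ((τs s)ᵀ ⊗ₖ (ωt t)ᵀ) →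
      ∀ ρ : Matrix (α × β) (α × β) ℂ,
        (∑ s, ∑ t, (a s t : ℂ) * ((ΦA ⊗ₖ ΦB) * Mop (τs s) ρ (ωt t)).trace)
          = (W * ρ).trace / ((Fintype.card α : ℂ) * (Fintype.card β : ℂ))) := by
  have outcome (τ : Matrix α α ℂ) (ρ : Matrix (α × β) (α × β) ℂ) (ω : Matrix β β ℂ) :
      ((ΦA ⊗ₖ ΦB) * Mop τ ρ ω).trace
        = ((τᵀ ⊗ₖ ωᵀ) * ρ).trace / ((Fintype.card α : ℂ) * (Fintype.card β : ℂ)) := by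
    rw [hΦA, hΦB, trace_maxEntangled_kronecker_mul_Mop, one_div_mul_one_div, one_div_mul_eq_div]
  refine ⟨outcome, ?_⟩
  rintro S T _ _ τs ωt a W rfl ρ
  simp only [outcome, Finset.sum_mul, Matrix.trace_sum, Matrix.smul_mul, Matrix.trace_smul,
    smul_eq_mul, Finset.sum_div, mul_div_assoc]

end
end

section
/- (Partial transpose of a separable state is positive semidefinite.) Let α and β be nonempty finite types and let σ be a separable density matrix indexed by α × β. Then the partial transpose σ^{T_B} is positive semidefinite. -/
open Matrix Kronecker BigOperators ComplexOrder

noncomputable section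

@[simp]
theorem ptB_kronecker {α β : Type*} (A : Matrix α α ℂ) (B : Matrix β β ℂ) :
    ptB (A ⊗ₖ B) = A ⊗ₖ Bᵀ := rfl

theorem ptB_smul {α β : Type*} (c : ℂ) (M : Matrix (α × β) (α × β) ℂ) :
    ptB (c • M) = c • ptB M := rfl

theorem ptB_sum {α β ι : Type*} (s : Finset ι) (M : ι → Matrix (α × β) (α × β) ℂ) :
    ptB (∑ i ∈ s, M i) = ∑ i ∈ s, ptB (M i) := by
  ext x y
  simp [ptB, Matrix.sum_apply]

/-- The partial transpose of a separable density matrix is positive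
semidefinite. -/
theorem sep_partial_transpose_posSemidef
    {α β : Type*} [Fintype α] [Nonempty α] [Fintype β] [Nonempty β]
    (σ : Matrix (α × β) (α × β) ℂ) (hσ : IsSepDensity σ) :
    (ptB σ).PosSemidef := by
  obtain ⟨m, p, A, B, hp, -, hA, hB, rfl⟩ := hσ
  simp only [ptB_sum, ptB_smul, ptB_kronecker]
  exact Matrix.posSemidef_sum _ fun i _ =>
    ((hA i).1.kronecker (hB i).1.transpose).smul (Complex.zero_le_real.2 (hp i))

end
end

section
/- (The partial-transposed projector is an entanglement witness detecting an NPT state.) Let α and β be nonempty finite types, let ρ̃ be a density matrix indexed by α × β, and let φ be a vector indexed by α × β such that the quadratic form ⟨φ, ρ̃^{T_B}·φ⟩ is a strictly negative real number. Define W = (φφ*)^{T_B}, the partial transpose of the rank-one matrix φφ* (where (φφ*)[x,y] = φ[x]·conj(φ[y])). Then (i) for every separable density matrix σ indexed by α × β, tr(W·σ) is a nonnegative real number; and (ii) tr(W·ρ̃) = ⟨φ, ρ̃^{T_B}·φ⟩ < 0. -/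
open Matrix Kronecker BigOperators ComplexOrder

noncomputable section

/-- Partial transposition is self-adjoint for the trace pairing. -/
theorem trace_ptB_mul {α β : Type*} [Fintype α] [Fintype β]
    (M N : Matrix (α × β) (α × β) ℂ) :
    (ptB M * N).trace = (M * ptB N).trace := by
  simp only [Matrix.trace, Matrix.diag_apply, Matrix.mul_apply, ptB, Matrix.of_apply,
    Fintype.sum_prod_type]
  refine Finset.sum_congr rfl fun a _ => ?_
  rw [Finset.sum_comm]
  conv_rhs => rw [Finset.sum_comm]
  refine Finset.sum_congr rfl fun a' _ => ?_
  rw [Finset.sum_comm]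

theorem trace_ptB_vecMulVec_mul {α β : Type*} [Fintype α] [Fintype β]
    (φ : α × β → ℂ) (N : Matrix (α × β) (α × β) ℂ) :
    (ptB (Matrix.vecMulVec φ (star φ)) * N).trace = star φ ⬝ᵥ (ptB N *ᵥ φ) := by
  rw [trace_ptB_mul, Matrix.vecMulVec_mul, Matrix.trace_vecMulVec, dotProduct_comm,
    Matrix.dotProduct_mulVec]

/-- Separable density matrices have positive partial transpose. -/
theorem IsSepDensity.posSemidef_ptB {α β : Type*} [Fintype α] [Fintype β]
    {σ : Matrix (α × β) (α × β) ℂ} (hσ : IsSepDensity σ) : (ptB σ).PosSemidef := by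
  obtain ⟨m, p, A, B, hp, -, hA, hB, rfl⟩ := hσ
  have h : ptB (∑ i, (p i : ℂ) • (A i ⊗ₖ B i)) = ∑ i, (p i : ℂ) • (A i ⊗ₖ (B i)ᵀ) := by
    ext x y
    simp [ptB, Matrix.sum_apply, Matrix.kroneckerMap_apply]
  rw [h]
  refine Matrix.posSemidef_sum _ fun i _ => ?_
  exact ((hA i).1.kronecker (hB i).1.transpose).smul (by exact_mod_cast hp i)

/-- The partial transpose of the projector onto a negative-eigenvalue
direction of `ρ̃^{T_B}` is an entanglement witness detecting the NPT state `ρ̃`. -/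
theorem npt_witness
    {α β : Type*} [Fintype α] [Nonempty α] [Fintype β] [Nonempty β]
    (ρ : Matrix (α × β) (α × β) ℂ) (hρ : IsDensity ρ)
    (φ : α × β → ℂ)
    (hneg : star φ ⬝ᵥ (ptB ρ *ᵥ φ) < 0) :
    (∀ σ : Matrix (α × β) (α × β) ℂ, IsSepDensity σ →
        0 ≤ (ptB (Matrix.vecMulVec φ (star φ)) * σ).trace) ∧
    (ptB (Matrix.vecMulVec φ (star φ)) * ρ).trace = star φ ⬝ᵥ (ptB ρ *ᵥ φ) ∧
    (ptB (Matrix.vecMulVec φ (star φ)) * ρ).trace < 0 := by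
  have h := trace_ptB_vecMulVec_mul φ
  refine ⟨fun σ hσ => ?_, h ρ, (h ρ).trans_lt hneg⟩
  rw [h]
  exact hσ.posSemidef_ptB.dotProduct_mulVec_nonneg φ

end
end
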